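/- Let H be a bounded self-adjoint operator on a complex Hilbert space and T an antilinear bounded operator with T² = Id and TH = HT. If the kernel of H is finite-dimensional and every u ∈ ker H can be decomposed via T, and moreover there is a linear involution structure splitting ker H into u and Tu linearly independent pairs whenever u is supported on only one of two complementary T-exchanged subspaces, then dim ker H is even. Concretely: suppose the Hilbert space is X ⊕ X, T(x, y) = (ȳ, x̄) (componentwise complex conjugation composed with swapping), and H = [[0, A], [A*, 0]] for a bounded operator A on X with real matrix coefficients in some orthonormal basis. Then the kernel of H is even-dimensional. -/

import Mathlib

open ContinuousLinearMap

/-- Abstract chiral/antiunitary setup: `H = [[0, A], [A*, 0]]` acting on `E × E` by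
`H(x, y) = (A y, A* x)`, together with a componentwise "complex conjugation" `J`
(an antilinear involution commuting with `A` in the sense that `A* ∘ J = J ∘ A`,
encoding that `A` has real matrix coefficients in some orthonormal basis; the
symmetry `T(x, y) = (J y, J x)` then commutes with `H`). The kernel of `H`, if
finite-dimensional, is even-dimensional. -/
theorem ker_even_dimensional {E : Type*} [NormedAddCommGroup E]
    [InnerProductSpace ℂ E] [CompleteSpace E]
    (A : E →L[ℂ] E) (J : E → E)
    (hJadd : ∀ x y : E, J (x + y) = J x + J y)
    (hJsmul : ∀ (a : ℂ) (x : E), J (a • x) = (starRingEnd ℂ) a • J x)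
    (hJJ : ∀ x : E, J (J x) = x)
    (hJA : ∀ x : E, (ContinuousLinearMap.adjoint A) (J x) = J (A x))
    (H : (E × E) →ₗ[ℂ] (E × E))
    (hH : ∀ p : E × E, H p = (A p.2, (ContinuousLinearMap.adjoint A) p.1))
    (hfin : FiniteDimensional ℂ (LinearMap.ker H)) :
    Even (Module.finrank ℂ (LinearMap.ker H)) := by
  let B := ContinuousLinearMap.adjoint A
  have hJ0 : J 0 = 0 := by simpa using hJadd 0 0
  let K := LinearMap.ker A.toLinearMap
  let L := LinearMap.ker B.toLinearMap
  have hK : ∀ x, x ∈ K ↔ A x = 0 := fun x => LinearMap.mem_ker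
  have hL : ∀ x, x ∈ L ↔ ContinuousLinearMap.adjoint A x = 0 := fun x => LinearMap.mem_ker
  have hker : ∀ p : E × E, p ∈ LinearMap.ker H ↔ p.1 ∈ L ∧ p.2 ∈ K := by
    intro p
    rw [LinearMap.mem_ker, hH, hK, hL, Prod.mk_eq_zero, and_comm]
  let e : LinearMap.ker H ≃ₗ[ℂ] (L × K) :=
    { toFun := fun p => (⟨p.1.1, ((hker p.1).1 p.2).1⟩, ⟨p.1.2, ((hker p.1).1 p.2).2⟩)
      invFun := fun q => ⟨(q.1.1, q.2.1), (hker _).2 ⟨q.1.2, q.2.2⟩⟩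
      map_add' := fun _ _ => rfl
      map_smul' := fun _ _ => rfl
      left_inv := fun _ => rfl
      right_inv := fun _ => rfl }
  have hLK : Module.Finite ℂ (L × K) := Module.Finite.equiv e
  have : Module.Finite ℂ L :=
    Module.Finite.of_surjective (LinearMap.fst ℂ L K) LinearMap.fst_surjective
  have : Module.Finite ℂ K :=
    Module.Finite.of_surjective (LinearMap.snd ℂ L K) LinearMap.snd_surjective
  have hto : ∀ x, x ∈ K → J x ∈ L := by
    intro x hx
    rw [hL, hJA, (hK x).1 hx, hJ0]
  have hfrom : ∀ x, x ∈ L → J x ∈ K := by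
    intro x hx
    rw [hK, ← hJJ (A (J x)), ← hJA, hJJ, (hL x).1 hx, hJ0]
  let j : K ≃+ L :=
    { toFun := fun x => ⟨J x.1, hto _ x.2⟩
      invFun := fun x => ⟨J x.1, hfrom _ x.2⟩
      map_add' := fun x y => Subtype.ext (hJadd _ _)
      left_inv := fun x => Subtype.ext (hJJ _)
      right_inv := fun x => Subtype.ext (hJJ _) }
  have hr : Module.rank ℂ K = Module.rank ℂ L :=
    rank_eq_of_equiv_equiv (starRingEnd ℂ) j (starRingAut (R := ℂ)).bijective
      (fun r m => Subtype.ext (hJsmul r m.1))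
  have hf : Module.finrank ℂ K = Module.finrank ℂ L := by
    unfold Module.finrank
    rw [hr]
  rw [e.finrank_eq, Module.finrank_prod, hf]
  exact ⟨_, rfl⟩
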